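/- arXiv:0906.4309 — 10 statements merged into one kernel-verified Lean document; each statement's English description precedes it below -/
import Mathlib

section
/- For every binary cubic P over k: if μ(P) = 0 then Ψ(P) = 0, and if Ψ(P) = 0 then Q_n(P) = 0. -/
open MvPolynomial

/-- A binary cubic `a·x³ + 3b·x²y + 3c·xy² + d·y³`, recorded by its coefficients. -/
structure BinCubic (k : Type*) where
  a : k
  b : k
  c : k
  d : k

namespace BinCubic

variable {k : Type*} [Field k]

instance : Zero (BinCubic k) := ⟨⟨0, 0, 0, 0⟩⟩

instance : Add (BinCubic k) :=
  ⟨fun P Q => ⟨P.a + Q.a, P.b + Q.b, P.c + Q.c, P.d + Q.d⟩⟩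

instance : Neg (BinCubic k) := ⟨fun P => ⟨-P.a, -P.b, -P.c, -P.d⟩⟩

instance : Sub (BinCubic k) :=
  ⟨fun P Q => ⟨P.a - Q.a, P.b - Q.b, P.c - Q.c, P.d - Q.d⟩⟩

instance : SMul k (BinCubic k) := ⟨fun t P => ⟨t * P.a, t * P.b, t * P.c, t * P.d⟩⟩

/-- The homogeneous cubic polynomial in `k[x,y]` attached to a binary cubic. -/
noncomputable def toPoly (P : BinCubic k) : MvPolynomial (Fin 2) k :=
  C P.a * X 0 ^ 3 + C (3 * P.b) * X 0 ^ 2 * X 1 +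
    C (3 * P.c) * X 0 * X 1 ^ 2 + C P.d * X 1 ^ 3

/-- The linear form `e·x + f·y`. -/
noncomputable def lin (e f : k) : MvPolynomial (Fin 2) k := C e * X 0 + C f * X 1

/-- A binary quadratic `u·x² + v·xy + w·y²`. -/
noncomputable def quadPoly (u v w : k) : MvPolynomial (Fin 2) k :=
  C u * X 0 ^ 2 + C v * (X 0 * X 1) + C w * X 1 ^ 2

/-- The moment map `μ`. -/
def mu (P : BinCubic k) : Matrix (Fin 2) (Fin 2) k :=
  !![P.a * P.d - P.b * P.c, 2 * (P.b * P.d - P.c ^ 2);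
     2 * (P.b ^ 2 - P.a * P.c), -(P.a * P.d - P.b * P.c)]

/-- The normalized quartic invariant `Q_n`. -/
def Qn (P : BinCubic k) : k :=
  P.a ^ 2 * P.d ^ 2 - 3 * P.b ^ 2 * P.c ^ 2 - 6 * P.a * P.b * P.c * P.d +
    4 * P.b ^ 3 * P.d + 4 * P.a * P.c ^ 3

/-- The derivation action of the trace-free matrix `M = [[α,β],[γ,−α]]` on binary cubics,
induced by `M·x = −αx − βy`, `M·y = −γx + αy`.  Explicitly,
`M·P = (−3aα−3bγ)x³ + (−3aβ−3bα−6cγ)x²y + (−6bβ+3cα−3dγ)xy² + (−3cβ+3dα)y³`. -/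
def matAct (M : Matrix (Fin 2) (Fin 2) k) (P : BinCubic k) : BinCubic k :=
  ⟨-(3 * P.a * M 0 0) - 3 * P.b * M 1 0,
   -(P.a * M 0 1) - P.b * M 0 0 - 2 * P.c * M 1 0,
   -(2 * P.b * M 0 1) + P.c * M 0 0 - P.d * M 1 0,
   -(3 * P.c * M 0 1) + 3 * P.d * M 0 0⟩

/-- The cubic covariant `Ψ(P) = μ(P)·P`. -/
def Psi (P : BinCubic k) : BinCubic k := matAct (mu P) P

/-- The symplectic form `ω` on binary cubics. -/
def omega (P Q : BinCubic k) : k :=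
  P.a * Q.d - P.d * Q.a - 3 * P.b * Q.c + 3 * P.c * Q.b

/-- `λ·(ex+fy)³` as a binary cubic. -/
def cubeForm (lam e f : k) : BinCubic k :=
  ⟨lam * e ^ 3, lam * e ^ 2 * f, lam * e * f ^ 2, lam * f ^ 3⟩

/-- The action on binary cubics of the algebra substitution `x ↦ px + qy`, `y ↦ rx + sy`. -/
def substAct (p q r s : k) (P : BinCubic k) : BinCubic k :=
  ⟨P.a * p ^ 3 + 3 * P.b * p ^ 2 * r + 3 * P.c * p * r ^ 2 + P.d * r ^ 3,
   P.a * p ^ 2 * q + P.b * (p ^ 2 * s + 2 * p * q * r) + P.c * (2 * p * r * s + q * r ^ 2) +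
     P.d * r ^ 2 * s,
   P.a * p * q ^ 2 + P.b * (2 * p * q * s + q ^ 2 * r) + P.c * (p * s ^ 2 + 2 * q * r * s) +
     P.d * r * s ^ 2,
   P.a * q ^ 3 + 3 * P.b * q ^ 2 * s + 3 * P.c * q * s ^ 2 + P.d * s ^ 3⟩

/-- `M^{⊗3}` acting on binary cubics for a trace-free `M = [[α,β],[γ,−α]]`: the algebra
substitution `x ↦ −αx − βy`, `y ↦ −γx + αy`; it sends `φ³` to `(M·φ)³` for linear forms `φ`. -/
def tensorCubeAct (M : Matrix (Fin 2) (Fin 2) k) (P : BinCubic k) : BinCubic k :=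
  substAct (-(M 0 0)) (-(M 0 1)) (-(M 1 0)) (M 0 0) P

/-- Action of a trace-free matrix `M = [[α,β],[γ,−α]]` on the linear form `ex + fy`
(`M·x = −αx − βy`, `M·y = −γx + αy`), recorded by the resulting pair of coefficients. -/
def linAct (M : Matrix (Fin 2) (Fin 2) k) (e f : k) : k × k :=
  (-(e * M 0 0) - f * M 1 0, -(e * M 0 1) + f * M 0 0)

/-- Evaluation of `P` at the point `(u, w) ∈ k²`. -/
def evalAt (P : BinCubic k) (u w : k) : k :=
  P.a * u ^ 3 + 3 * P.b * u ^ 2 * w + 3 * P.c * u * w ^ 2 + P.d * w ^ 3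

/-- The symplectic form `Ω` on `k²`. -/
def Omeg (v w : Fin 2 → k) : k := v 0 * w 1 - v 1 * w 0

/-- The action of `g = [[α,β],[γ,δ]]` on polynomials by the algebra substitution
`g·x = δx − βy`, `g·y = −γx + αy`. -/
noncomputable def slAct (g : Matrix (Fin 2) (Fin 2) k) (P : MvPolynomial (Fin 2) k) :
    MvPolynomial (Fin 2) k :=
  aeval ![C (g 1 1) * X 0 - C (g 0 1) * X 1, C (g 0 0) * X 1 - C (g 1 0) * X 0] P

/-- The symmetric bilinear polarization `B_μ` of the moment map: `B_μ(P,P) = μ(P)`. -/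
def Bmu (P Q : BinCubic k) : Matrix (Fin 2) (Fin 2) k :=
  !![(P.a * Q.d + P.d * Q.a - P.b * Q.c - P.c * Q.b) / 2,
       (P.b * Q.d + P.d * Q.b) - P.c * Q.c;
     P.b * Q.b - (P.a * Q.c + P.c * Q.a),
       -((P.a * Q.d + P.d * Q.a - P.b * Q.c - P.c * Q.b) / 2)]

/-- `P` is reducible over `k`: it factors as (nonzero linear form)·(binary quadratic). -/
def IsReducible (P : BinCubic k) : Prop :=
  ∃ e f u v w : k, (e ≠ 0 ∨ f ≠ 0) ∧ toPoly P = lin e f * quadPoly u v w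

end BinCubic

namespace BinCubic

variable {k : Type*} [Field k]

/-- The quartic invariant of the cubic covariant is `81` times the cube of the invariant. -/
theorem Qn_Psi (P : BinCubic k) : Qn (Psi P) = 81 * Qn P ^ 3 := by
  simp [Qn, Psi, matAct, mu]
  ring

theorem Qn_zero : Qn (0 : BinCubic k) = 0 := by
  change Qn (⟨0, 0, 0, 0⟩ : BinCubic k) = 0
  simp [Qn]

theorem matAct_zero (P : BinCubic k) : matAct 0 P = 0 := by
  change matAct 0 P = ⟨0, 0, 0, 0⟩
  simp [matAct]

end BinCubic

open BinCubic
/-- if `μ(P) = 0` then `Ψ(P) = 0`, and if `Ψ(P) = 0` then `Q_n(P) = 0`. -/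
theorem stmt0 {k : Type*} [Field k] (h2 : (2 : k) ≠ 0) (h3 : (3 : k) ≠ 0)
    (P : BinCubic k) :
    (mu P = 0 → Psi P = (0 : BinCubic k)) ∧ (Psi P = (0 : BinCubic k) → Qn P = 0) := by
  refine ⟨fun h => by rw [Psi, h, matAct_zero], fun h => ?_⟩
  have hQ : 81 * Qn P ^ 3 = 0 := by rw [← Qn_Psi, h, Qn_zero]
  have h81 : (81 : k) ≠ 0 := by
    convert pow_ne_zero 4 h3 using 1
    norm_num
  exact eq_zero_of_pow_eq_zero ((mul_eq_zero.mp hQ).resolve_left h81)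
end

section
/- (Classical Eisenstein syzygy) For every binary cubic P over k and every vector v = (v₁,v₂) ∈ k²: Ψ(P)(v₁,v₂)² − 9·Q_n(P)·P(v₁,v₂)² = −(9/2)·Ω(μ(P)·v, v)³, where μ(P)·v is ordinary matrix-vector multiplication. -/
open MvPolynomial

open BinCubic
/-- the classical Eisenstein syzygy
`Ψ(P)(v)² − 9·Q_n(P)·P(v)² = −(9/2)·Ω(μ(P)·v, v)³`. -/
theorem stmt1 {k : Type*} [Field k] (h2 : (2 : k) ≠ 0) (h3 : (3 : k) ≠ 0)
    (P : BinCubic k) (v : Fin 2 → k) :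
    evalAt (Psi P) (v 0) (v 1) ^ 2 - 9 * Qn P * evalAt P (v 0) (v 1) ^ 2 =
      -(9 / 2 : k) * Omeg ((mu P).mulVec v) v ^ 3 := by
  simp only [evalAt, Psi, matAct, mu, Qn, Omeg, Matrix.mulVec, dotProduct, Fin.sum_univ_two,
    Matrix.of_apply, Matrix.cons_val_zero, Matrix.cons_val_one, Matrix.cons_val']
  field_simp
  ring
end

section
/- (Symplectic Eisenstein identity) For all binary cubics P and Q over k: ω(Ψ(P),Q)² − 9·Q_n(P)·ω(P,Q)² = −(9/2)·ω(μ(P)^{⊗3}·Q, Q) − (9/2)·Q_n(P)·ω(μ(P)·Q, Q). -/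
open MvPolynomial

open BinCubic
/-- the symplectic Eisenstein identity
`ω(Ψ(P),Q)² − 9·Q_n(P)·ω(P,Q)² = −(9/2)·ω(μ(P)^{⊗3}·Q, Q) − (9/2)·Q_n(P)·ω(μ(P)·Q, Q)`. -/
theorem stmt2 {k : Type*} [Field k] (h2 : (2 : k) ≠ 0) (h3 : (3 : k) ≠ 0)
    (P Q : BinCubic k) :
    omega (Psi P) Q ^ 2 - 9 * Qn P * omega P Q ^ 2 =
      -(9 / 2 : k) * omega (tensorCubeAct (mu P) Q) Q
        - (9 / 2 : k) * Qn P * omega (matAct (mu P) Q) Q := by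
  simp only [Psi, tensorCubeAct, substAct, matAct, omega, Qn, mu, Matrix.of_apply,
    Matrix.cons_val', Matrix.cons_val_zero, Matrix.cons_val_one, Matrix.cons_val_fin_one]
  field_simp
  ring
end

section
/- Let Δ ∈ k and let X, X' be nonzero trace-free 2×2 matrices over k with det X = det X' = Δ. Let v, v' ∈ k² be non-eigenvectors of X and of X' respectively. Then Ω(v, Xv) ≠ 0 and Ω(v', X'v') ≠ 0, and there exists g ∈ SL(2,k) with gXg⁻¹ = X' if and only if there exist a, b ∈ k such that Ω(v', X'v') = (a² + b²·Δ)·Ω(v, Xv). -/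
open MvPolynomial

open BinCubic
theorem Omeg_mulVec_mulVec {k : Type*} [Field k] (g : Matrix (Fin 2) (Fin 2) k)
    (v w : Fin 2 → k) : Omeg (g.mulVec v) (g.mulVec w) = g.det * Omeg v w := by
  simp only [Omeg, Matrix.mulVec, dotProduct, Fin.sum_univ_two, Matrix.det_fin_two]
  ring

theorem Omeg_ne_zero_of_not_smul {k : Type*} [Field k] {v w : Fin 2 → k}
    (h : ¬ ∃ t : k, w = t • v) (hw : v = 0 → w = 0) : Omeg v w ≠ 0 := by
  intro h0
  simp only [Omeg] at h0
  apply h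
  by_cases hv0 : v 0 = 0
  · by_cases hv1 : v 1 = 0
    · exact ⟨0, by rw [hw (by ext i; fin_cases i <;> simp [hv0, hv1])]; simp⟩
    · refine ⟨w 1 / v 1, ?_⟩
      ext i
      fin_cases i
      · simp only [Fin.zero_eta, Pi.smul_apply, smul_eq_mul]
        field_simp
        linear_combination -h0
      · simp [hv1]
  · refine ⟨w 0 / v 0, ?_⟩
    ext i
    fin_cases i
    · simp [hv0]
    · simp only [Fin.mk_one, Pi.smul_apply, smul_eq_mul]
      field_simp
      linear_combination h0

theorem Omeg_mulVec_ne_zero {k : Type*} [Field k] {X : Matrix (Fin 2) (Fin 2) k}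
    {v : Fin 2 → k} (hv : ¬ ∃ t : k, X.mulVec v = t • v) : Omeg v (X.mulVec v) ≠ 0 :=
  Omeg_ne_zero_of_not_smul hv (by rintro rfl; simp)

theorem exists_eq_smul_add_smul_of_Omeg_ne_zero {k : Type*} [Field k] {v w : Fin 2 → k}
    (h : Omeg v w ≠ 0) (u : Fin 2 → k) : ∃ a b : k, u = a • v + b • w := by
  refine ⟨Omeg u w / Omeg v w, Omeg v u / Omeg v w, ?_⟩
  ext i
  simp only [Pi.add_apply, Pi.smul_apply, smul_eq_mul]
  field_simp
  fin_cases i <;> simp only [Omeg, Fin.zero_eta, Fin.mk_one] <;> ring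

/-- The quadratic form `w ↦ Ω(w, Xw)` in the basis `v, Xv`. -/
theorem Omeg_mulVec_smul_add_smul {k : Type*} [Field k] {X : Matrix (Fin 2) (Fin 2) k}
    (htr : X.trace = 0) (v : Fin 2 → k) (a b : k) :
    Omeg (a • v + b • X.mulVec v) (X.mulVec (a • v + b • X.mulVec v)) =
      (a ^ 2 + b ^ 2 * X.det) * Omeg v (X.mulVec v) := by
  have h : X 1 1 = -X 0 0 := by
    rw [Matrix.trace_fin_two] at htr
    linear_combination htr
  simp only [Omeg, Matrix.mulVec, dotProduct, Fin.sum_univ_two, Matrix.det_fin_two,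
    Pi.add_apply, Pi.smul_apply, smul_eq_mul, h]
  ring

/-- The matrix with columns `v` and `Xv`. -/
def krylovMatrix {k : Type*} [Field k] (X : Matrix (Fin 2) (Fin 2) k) (v : Fin 2 → k) :
    Matrix (Fin 2) (Fin 2) k :=
  !![v 0, X.mulVec v 0; v 1, X.mulVec v 1]

theorem det_krylovMatrix {k : Type*} [Field k] (X : Matrix (Fin 2) (Fin 2) k)
    (v : Fin 2 → k) : (krylovMatrix X v).det = Omeg v (X.mulVec v) := by
  simp only [krylovMatrix, Matrix.det_fin_two_of, Omeg]
  ring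

theorem mul_krylovMatrix {k : Type*} [Field k] {X : Matrix (Fin 2) (Fin 2) k}
    (htr : X.trace = 0) (v : Fin 2 → k) :
    X * krylovMatrix X v = krylovMatrix X v * !![0, -X.det; 1, 0] := by
  have h : X 1 1 = -X 0 0 := by
    rw [Matrix.trace_fin_two] at htr
    linear_combination htr
  ext i j
  fin_cases i <;> fin_cases j <;>
    simp [krylovMatrix, Matrix.mul_apply, Fin.sum_univ_two, Matrix.mulVec, dotProduct,
      Matrix.det_fin_two, h] <;> ring

theorem exists_conj_eq_of_Omeg_eq {k : Type*} [Field k] {X X' : Matrix (Fin 2) (Fin 2) k}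
    (htr : X.trace = 0) (htr' : X'.trace = 0) (hdet : X.det = X'.det) {w v' : Fin 2 → k}
    (h : Omeg v' (X'.mulVec v') = Omeg w (X.mulVec w)) (h0 : Omeg w (X.mulVec w) ≠ 0) :
    ∃ g : Matrix.SpecialLinearGroup (Fin 2) k,
      (g : Matrix (Fin 2) (Fin 2) k) * X *
        ((g⁻¹ : Matrix.SpecialLinearGroup (Fin 2) k) : Matrix (Fin 2) (Fin 2) k) = X' := by
  have hP : IsUnit (krylovMatrix X w).det := by
    rw [det_krylovMatrix]
    exact h0.isUnit
  have hg : (krylovMatrix X' v' * (krylovMatrix X w)⁻¹).det = 1 := by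
    rw [Matrix.det_mul, det_krylovMatrix, h, ← det_krylovMatrix, ← Matrix.det_mul,
      Matrix.mul_nonsing_inv _ hP, Matrix.det_one]
  have hcomm : krylovMatrix X' v' * (krylovMatrix X w)⁻¹ * X =
      X' * (krylovMatrix X' v' * (krylovMatrix X w)⁻¹) := by
    have hX : (krylovMatrix X w)⁻¹ * X = !![0, -X.det; 1, 0] * (krylovMatrix X w)⁻¹ := by
      calc (krylovMatrix X w)⁻¹ * X
          = (krylovMatrix X w)⁻¹ * (X * krylovMatrix X w) * (krylovMatrix X w)⁻¹ := by
            rw [Matrix.mul_assoc, Matrix.mul_nonsing_inv_cancel_right _ _ hP]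
        _ = _ := by
            rw [mul_krylovMatrix htr, Matrix.nonsing_inv_mul_cancel_left _ _ hP]
    rw [Matrix.mul_assoc, hX, ← Matrix.mul_assoc, ← Matrix.mul_assoc, mul_krylovMatrix htr',
      hdet]
  let g : Matrix.SpecialLinearGroup (Fin 2) k := ⟨_, hg⟩
  refine ⟨g, ?_⟩
  have hgX : (g : Matrix (Fin 2) (Fin 2) k) * X = X' * g := hcomm
  rw [hgX, Matrix.mul_assoc, ← Matrix.SpecialLinearGroup.coe_mul, mul_inv_cancel,
    Matrix.SpecialLinearGroup.coe_one, Matrix.mul_one]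

/-- classification of `SL(2,k)`-orbits on trace-free matrices of fixed
determinant via the invariant `ν_Δ(X) = [Ω(v, Xv)]`. -/
theorem stmt3 {k : Type*} [Field k] (h2 : (2 : k) ≠ 0) (h3 : (3 : k) ≠ 0)
    (Δ : k) (X X' : Matrix (Fin 2) (Fin 2) k)
    (hX : X ≠ 0) (hX' : X' ≠ 0)
    (htr : X.trace = 0) (htr' : X'.trace = 0)
    (hdet : X.det = Δ) (hdet' : X'.det = Δ)
    (v v' : Fin 2 → k)
    (hv : ¬ ∃ t : k, X.mulVec v = t • v)
    (hv' : ¬ ∃ t : k, X'.mulVec v' = t • v') :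
    Omeg v (X.mulVec v) ≠ 0 ∧ Omeg v' (X'.mulVec v') ≠ 0 ∧
      ((∃ g : Matrix.SpecialLinearGroup (Fin 2) k,
          (g : Matrix (Fin 2) (Fin 2) k) * X * ((g⁻¹ : Matrix.SpecialLinearGroup (Fin 2) k) : Matrix (Fin 2) (Fin 2) k) = X') ↔
        ∃ a b : k, Omeg v' (X'.mulVec v') = (a ^ 2 + b ^ 2 * Δ) * Omeg v (X.mulVec v)) := by
  have hq := Omeg_mulVec_ne_zero hv
  have hq' := Omeg_mulVec_ne_zero hv'
  refine ⟨hq, hq', ?_, ?_⟩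
  · rintro ⟨g, rfl⟩
    obtain ⟨a, b, hab⟩ := exists_eq_smul_add_smul_of_Omeg_ne_zero hq
      (((g⁻¹ : Matrix.SpecialLinearGroup (Fin 2) k) : Matrix (Fin 2) (Fin 2) k).mulVec v')
    refine ⟨a, b, ?_⟩
    rw [← hdet, ← Omeg_mulVec_smul_add_smul htr, ← hab]
    have hgv : (g : Matrix (Fin 2) (Fin 2) k).mulVec
        (((g⁻¹ : Matrix.SpecialLinearGroup (Fin 2) k) : Matrix (Fin 2) (Fin 2) k).mulVec v') =
          v' := by
      rw [Matrix.mulVec_mulVec, ← Matrix.SpecialLinearGroup.coe_mul, mul_inv_cancel,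
        Matrix.SpecialLinearGroup.coe_one, Matrix.one_mulVec]
    rw [← Matrix.mulVec_mulVec, ← Matrix.mulVec_mulVec]
    conv_lhs => enter [1]; rw [← hgv]
    rw [Omeg_mulVec_mulVec, Matrix.SpecialLinearGroup.det_coe, one_mul]
  · rintro ⟨a, b, hab⟩
    rw [← hdet, ← Omeg_mulVec_smul_add_smul htr] at hab
    exact exists_conj_eq_of_Omeg_eq htr htr' (hdet.trans hdet'.symm) hab (hab ▸ hq')
end

section
/- (Image of the moment map) Let X be a nonzero trace-free 2×2 matrix over k. Then there exists a binary cubic P over k with μ(P) = X if and only if there exist a non-eigenvector v ∈ k² of X and elements a, b ∈ k such that Ω(v, Xv) = 2(a² + b²·det X). -/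
open MvPolynomial

open BinCubic
namespace BinCubic

variable {k : Type*} [Field k]

/-- `μ` is a quadratic covariant of weight two under linear substitutions. -/
theorem mu_substAct (p q r s : k) (P : BinCubic k) :
    mu (substAct p q r s P) = (p * s - q * r) ^ 2 •
      !![mu P 0 0 * (p * s + q * r) - mu P 1 0 * (p * q) + mu P 0 1 * (r * s),
         mu P 0 1 * s ^ 2 + 2 * mu P 0 0 * (q * s) - mu P 1 0 * q ^ 2;
         mu P 1 0 * p ^ 2 - 2 * mu P 0 0 * (p * r) - mu P 0 1 * r ^ 2,
         -(mu P 0 0 * (p * s + q * r) - mu P 1 0 * (p * q) + mu P 0 1 * (r * s))] := by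
  ext i j
  fin_cases i <;> fin_cases j <;> simp [mu, substAct] <;> ring

/-- The polarization of `P` evaluated at `(v, v, w)`. -/
def polarAt (P : BinCubic k) (v w : Fin 2 → k) : k :=
  P.a * v 0 ^ 2 * w 0 + P.b * (v 0 ^ 2 * w 1 + 2 * v 0 * v 1 * w 0) +
    P.c * (2 * v 0 * v 1 * w 1 + v 1 ^ 2 * w 0) + P.d * v 1 ^ 2 * w 1

/-- The syzygy between the covariants of a binary cubic. -/
theorem Omeg_mu_mulVec_pow_three (P : BinCubic k) (v : Fin 2 → k) :
    Omeg v ((mu P).mulVec v) ^ 3 =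
      2 * (polarAt P v ((mu P).mulVec v) ^ 2 + evalAt P (v 0) (v 1) ^ 2 * (mu P).det) := by
  simp only [Omeg, polarAt, evalAt, mu, Matrix.mulVec, dotProduct, Fin.sum_univ_two,
    Matrix.det_fin_two, Matrix.of_apply, Matrix.cons_val', Matrix.cons_val_zero,
    Matrix.cons_val_one, Matrix.cons_val_fin_one]
  ring

theorem exists_smul_eq_iff_Omeg_eq_zero {v : Fin 2 → k} (hv : v ≠ 0) (w : Fin 2 → k) :
    (∃ t : k, w = t • v) ↔ Omeg v w = 0 := by
  constructor
  · rintro ⟨t, rfl⟩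
    simp only [Omeg, Pi.smul_apply, smul_eq_mul]
    ring
  · intro h
    simp only [Omeg] at h
    by_cases h0 : v 0 = 0
    · have h1 : v 1 ≠ 0 := fun h1 => hv (by ext i; fin_cases i <;> simp [h0, h1])
      have hw : w 0 = 0 := by simpa [h0, h1] using h
      refine ⟨w 1 / v 1, ?_⟩
      ext i
      fin_cases i <;> simp [h0, h1, hw]
    · refine ⟨w 0 / v 0, ?_⟩
      ext i
      fin_cases i
      · simp [h0]
      · simp only [Fin.mk_one, Pi.smul_apply, smul_eq_mul]
        field_simp
        linear_combination h

theorem exists_Omeg_mulVec_ne_zero (h2 : (2 : k) ≠ 0) {X : Matrix (Fin 2) (Fin 2) k}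
    (hX : X ≠ 0) (htr : X.trace = 0) : ∃ v : Fin 2 → k, Omeg v (X.mulVec v) ≠ 0 := by
  by_contra! h
  have h10 : X 1 0 = 0 := by simpa [Omeg, Matrix.mulVec, dotProduct] using h ![1, 0]
  have h01 : X 0 1 = 0 := by simpa [Omeg, Matrix.mulVec, dotProduct] using h ![0, 1]
  have h11 : X 1 1 - X 0 0 = 0 := by
    simpa [Omeg, Matrix.mulVec, dotProduct, h10, h01] using h ![1, 1]
  rw [Matrix.trace_fin_two] at htr
  have h00 : X 0 0 = 0 :=
    (mul_eq_zero.mp (by linear_combination htr - h11 : 2 * X 0 0 = 0)).resolve_left h2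
  have h11' : X 1 1 = 0 := by linear_combination h11 + h00
  exact hX (by ext i j; fin_cases i <;> fin_cases j <;> simp [h00, h01, h10, h11'])

/-- A cubic with `μ = X`, built in the basis `v`, `X v` of `k²`. -/
theorem exists_mu_eq {X : Matrix (Fin 2) (Fin 2) k} (htr : X.trace = 0) (v : Fin 2 → k)
    (a b : k) (hv : Omeg v (X.mulVec v) ≠ 0)
    (h : Omeg v (X.mulVec v) = 2 * (a ^ 2 + b ^ 2 * X.det)) : ∃ P : BinCubic k, mu P = X := by
  have h11 : X 1 1 = -X 0 0 := by
    rw [Matrix.trace_fin_two] at htr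
    linear_combination htr
  set w := X.mulVec v with hw
  set q := Omeg v w with hq
  set D := X.det with hD
  set R : BinCubic k := ⟨q * b, q * a, -(D * (q * b)), -(D * (q * a))⟩ with hR
  have hR00 : mu R 0 0 = 0 := by simp [mu, hR]; ring
  have hR01 : mu R 0 1 = -(D * q ^ 3) := by
    simp [mu, hR]; linear_combination D * q ^ 2 * h
  have hR10 : mu R 1 0 = q ^ 3 := by
    simp [mu, hR]; linear_combination -q ^ 2 * h
  have hw0 : w 0 = X 0 0 * v 0 + X 0 1 * v 1 := by
    simp [hw]
  have hw1 : w 1 = X 1 0 * v 0 - X 0 0 * v 1 := by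
    simp [hw, h11]; ring
  have hq' : q = v 0 * w 1 - v 1 * w 0 := hq
  have hD' : D = -X 0 0 ^ 2 - X 0 1 * X 1 0 := by
    rw [hD, Matrix.det_fin_two, h11]; ring
  have hdet : w 1 / q * (v 0 / q) - -(w 0) / q * (-(v 1) / q) = 1 / q := by
    field_simp
    rw [hq']; ring
  refine ⟨substAct (w 1 / q) (-(w 0) / q) (-(v 1) / q) (v 0 / q) R, ?_⟩
  rw [mu_substAct, hdet, hR00, hR01, hR10]
  clear_value w q D
  have e00 : (w 0 * w 1 + D * (v 0 * v 1)) = X 0 0 * q := by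
    rw [hq', hD', hw0, hw1]; ring
  have e01 : -(D * v 0 ^ 2) - w 0 ^ 2 = X 0 1 * q := by
    rw [hq', hD', hw0, hw1]; ring
  have e10 : w 1 ^ 2 + D * v 1 ^ 2 = X 1 0 * q := by
    rw [hq', hD', hw0, hw1]; ring
  ext i j
  fin_cases i <;> fin_cases j <;> simp [h11] <;> field_simp
  · linear_combination e00
  · linear_combination e01
  · linear_combination e10
  · linear_combination -e00

end BinCubic

/-- a nonzero trace-free `X` is in the image of the moment map iff
`Ω(v, Xv) = 2(a² + b²·det X)` for some non-eigenvector `v` and some `a, b ∈ k`. -/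
theorem stmt4 {k : Type*} [Field k] (h2 : (2 : k) ≠ 0) (h3 : (3 : k) ≠ 0)
    (X : Matrix (Fin 2) (Fin 2) k) (hX : X ≠ 0) (htr : X.trace = 0) :
    (∃ P : BinCubic k, mu P = X) ↔
      ∃ (v : Fin 2 → k) (a b : k), (¬ ∃ t : k, X.mulVec v = t • v) ∧
        Omeg v (X.mulVec v) = 2 * (a ^ 2 + b ^ 2 * X.det) := by
  constructor
  · rintro ⟨P, rfl⟩
    obtain ⟨v, hv⟩ := exists_Omeg_mulVec_ne_zero h2 hX htr
    have hv0 : v ≠ 0 := by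
      rintro rfl
      simp [Omeg] at hv
    refine ⟨v, polarAt P v ((mu P).mulVec v) / Omeg v ((mu P).mulVec v),
      evalAt P (v 0) (v 1) / Omeg v ((mu P).mulVec v),
      mt (exists_smul_eq_iff_Omeg_eq_zero hv0 _).mp hv, ?_⟩
    have h := Omeg_mu_mulVec_pow_three P v
    generalize Omeg v ((mu P).mulVec v) = q at *
    field_simp
    linear_combination h
  · rintro ⟨v, a, b, hv, h⟩
    have hv0 : v ≠ 0 := by
      rintro rfl
      exact hv ⟨0, by simp⟩
    exact exists_mu_eq htr v a b (mt (exists_smul_eq_iff_Omeg_eq_zero hv0 _).mpr hv) h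
end

section
/- A nonzero binary cubic P over k satisfies μ(P) = 0 if and only if there exist λ ∈ k with λ ≠ 0 and a nonzero linear form φ = ex + fy in k[x,y] such that P = λ·φ³ (i.e. P has a triple root). -/
open MvPolynomial

open BinCubic

namespace BinCubic

theorem toPoly_cubeForm {k : Type*} [Field k] (lam e f : k) :
    toPoly (cubeForm lam e f) = C lam * lin e f ^ 3 := by
  simp only [toPoly, cubeForm, lin, map_mul, map_pow, map_ofNat]
  ring

theorem eval_toPoly {k : Type*} [Field k] (P : BinCubic k) (u w : k) :
    eval ![u, w] (toPoly P) = evalAt P u w := by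
  simp [toPoly, evalAt]

theorem toPoly_injective {k : Type*} [Field k] (h2 : (2 : k) ≠ 0) (h3 : (3 : k) ≠ 0) :
    Function.Injective (toPoly : BinCubic k → MvPolynomial (Fin 2) k) := by
  rintro ⟨a, b, c, d⟩ ⟨a', b', c', d'⟩ h
  have key (u w : k) : evalAt ⟨a, b, c, d⟩ u w = evalAt ⟨a', b', c', d'⟩ u w := by
    rw [← eval_toPoly, ← eval_toPoly, h]
  simp only [evalAt] at key
  have ha : a = a' := by simpa using key 1 0
  have hd : d = d' := by simpa using key 0 1
  subst ha hd
  have h6 : (2 * 3 : k) ≠ 0 := mul_ne_zero h2 h3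
  have hb : b = b' := mul_left_cancel₀ h6 (by linear_combination key 1 1 - key 1 (-1))
  have hc : c = c' := mul_left_cancel₀ h6 (by linear_combination key 1 1 + key 1 (-1))
  rw [hb, hc]

theorem mu_cubeForm {k : Type*} [Field k] (lam e f : k) : mu (cubeForm lam e f) = 0 := by
  ext i j
  fin_cases i <;> fin_cases j <;> simp [mu, cubeForm, -mul_eq_zero] <;> ring

theorem mu_eq_zero_iff {k : Type*} [Field k] (h2 : (2 : k) ≠ 0) (P : BinCubic k) :
    mu P = 0 ↔ P.a * P.d = P.b * P.c ∧ P.b * P.d = P.c ^ 2 ∧ P.b ^ 2 = P.a * P.c := by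
  simp only [mu, ← Matrix.ext_iff, Fin.forall_fin_two]
  simp [h2, sub_eq_zero]
  tauto

theorem exists_eq_cubeForm_of_mu_eq_zero {k : Type*} [Field k] (h2 : (2 : k) ≠ 0)
    {P : BinCubic k} (hP : P ≠ 0) (h : mu P = 0) :
    ∃ lam e f : k, lam ≠ 0 ∧ (e ≠ 0 ∨ f ≠ 0) ∧ P = cubeForm lam e f := by
  obtain ⟨had, hbd, hbb⟩ := (mu_eq_zero_iff h2 P).1 h
  obtain ⟨a, b, c, d⟩ := P
  dsimp only at had hbd hbb
  by_cases ha : a = 0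
  · subst ha
    have hb : b = 0 := by simpa using hbb
    subst hb
    have hc : c = 0 := by simpa using hbd.symm
    subst hc
    refine ⟨d, 0, 1, ?_, Or.inr one_ne_zero, by simp [cubeForm]⟩
    rintro rfl
    exact hP rfl
  · refine ⟨a, 1, b / a, ha, Or.inl one_ne_zero, ?_⟩
    simp only [cubeForm, mk.injEq]
    refine ⟨by ring, by field_simp, ?_, ?_⟩
    · field_simp
      linear_combination -hbb
    · field_simp
      linear_combination a * had - b * hbb

end BinCubic


/-- a nonzero binary cubic has `μ(P) = 0` iff it is a nonzero multiple of the
cube of a nonzero linear form. -/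
theorem stmt6 {k : Type*} [Field k] (h2 : (2 : k) ≠ 0) (h3 : (3 : k) ≠ 0)
    (P : BinCubic k) (hP : P ≠ (0 : BinCubic k)) :
    mu P = 0 ↔
      ∃ lam e f : k, lam ≠ 0 ∧ (e ≠ 0 ∨ f ≠ 0) ∧
        toPoly P = MvPolynomial.C lam * lin e f ^ 3 := by
  constructor
  · intro h
    obtain ⟨lam, e, f, hlam, hef, rfl⟩ := exists_eq_cubeForm_of_mu_eq_zero h2 hP h
    exact ⟨lam, e, f, hlam, hef, toPoly_cubeForm lam e f⟩
  · rintro ⟨lam, e, f, -, -, h⟩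
    rw [← toPoly_cubeForm] at h
    rw [toPoly_injective h2 h3 h, mu_cubeForm]
end

section
/- Let P be a nonzero binary cubic over k. Then μ(P) is nonzero and nilpotent (equivalently, μ(P) ≠ 0 and μ(P)² = 0) if and only if there exist linear forms φ, ξ in k[x,y] with Ω(φ,ξ) ≠ 0 such that P = φ²·ξ (i.e. P has exactly a double root). -/
open MvPolynomial

open BinCubic
namespace BinCubic

theorem toPoly_eq_lin_sq_mul_lin_iff {k : Type*} [Field k] (h2 : (2 : k) ≠ 0)
    (P : BinCubic k) (e f r s : k) :
    toPoly P = lin e f ^ 2 * lin r s ↔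
      P.a = e ^ 2 * r ∧ 3 * P.b = e ^ 2 * s + 2 * e * f * r ∧
        3 * P.c = f ^ 2 * r + 2 * e * f * s ∧ P.d = f ^ 2 * s := by
  constructor
  · intro h
    have key : ∀ u v : k, P.a * u ^ 3 + 3 * P.b * u ^ 2 * v + 3 * P.c * u * v ^ 2 + P.d * v ^ 3 =
        (e * u + f * v) ^ 2 * (r * u + s * v) := fun u v => by
      simpa [toPoly, lin] using congrArg (MvPolynomial.eval ![u, v]) h
    have h10 := key 1 0
    have h01 := key 0 1
    have h11 := key 1 1
    have h1n := key 1 (-1)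
    refine ⟨by linear_combination h10, mul_left_cancel₀ h2 ?_, mul_left_cancel₀ h2 ?_,
      by linear_combination h01⟩
    · linear_combination h11 - h1n - 2 * h01
    · linear_combination h11 + h1n - 2 * h10
  · rintro ⟨ha, hb, hc, hd⟩
    rw [toPoly, lin, lin, ha, hb, hc, hd]
    simp only [map_add, map_mul, map_pow, map_ofNat]
    ring

theorem mu_sq_eq_zero_iff {k : Type*} [Field k] (P : BinCubic k) :
    mu P ^ 2 = 0 ↔ (P.a * P.d - P.b * P.c) ^ 2 +
      4 * (P.b ^ 2 - P.a * P.c) * (P.b * P.d - P.c ^ 2) = 0 := by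
  have key : mu P ^ 2 = ((P.a * P.d - P.b * P.c) ^ 2 +
      4 * (P.b ^ 2 - P.a * P.c) * (P.b * P.d - P.c ^ 2)) • (1 : Matrix (Fin 2) (Fin 2) k) := by
    ext i j
    fin_cases i <;> fin_cases j <;> simp [mu, pow_two, Matrix.mul_apply] <;> ring
  rw [key, smul_eq_zero, or_iff_left one_ne_zero]

/-- A binary cubic with vanishing discriminant whose Hessian has nonzero leading coefficient
has an exact double root, in coefficients. -/
theorem exists_double_root_of_disc_eq_zero {k : Type*} [Field k] (h2 : (2 : k) ≠ 0)
    (h3 : (3 : k) ≠ 0) {a b c d : k} (hp : b ^ 2 - a * c ≠ 0)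
    (hdisc : (a * d - b * c) ^ 2 + 4 * (b ^ 2 - a * c) * (b * d - c ^ 2) = 0) :
    ∃ e f r s : k, e * s - f * r ≠ 0 ∧ a = e ^ 2 * r ∧ 3 * b = e ^ 2 * s + 2 * e * f * r ∧
      3 * c = f ^ 2 * r + 2 * e * f * s ∧ d = f ^ 2 * s := by
  obtain ⟨p, hp'⟩ : ∃ p, p = b ^ 2 - a * c := ⟨_, rfl⟩
  obtain ⟨q, hq⟩ : ∃ q, q = b * d - c ^ 2 := ⟨_, rfl⟩
  obtain ⟨n, hn⟩ : ∃ n, n = a * d - b * c := ⟨_, rfl⟩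
  rw [← hp', ← hq, ← hn] at hdisc
  rw [← hp'] at hp
  have hc : a * q - b * n = c * p := by rw [hp', hq, hn]; ring
  have hd : b * q - c * n = d * p := by rw [hp', hq, hn]; ring
  have hsyz : (2 * b * p + n * a) ^ 2 = 4 * p ^ 3 := by
    have : (2 * b * p + n * a) ^ 2 = 4 * p ^ 3 + a ^ 2 * (n ^ 2 + 4 * p * q) := by
      rw [hp', hq, hn]; ring
    rw [this, hdisc]; ring
  have h4 : (4 : k) ≠ 0 := by
    have : (4 : k) = 2 * 2 := by norm_num
    rw [this]; exact mul_ne_zero h2 h2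
  have hpsi : 2 * b * p + n * a ≠ 0 := by
    intro h
    rw [h] at hsyz
    exact mul_ne_zero h4 (pow_ne_zero 3 hp) (by rw [← hsyz]; ring)
  refine ⟨2 * p, -n, a / (4 * p ^ 2), (3 * b * p + n * a) / (4 * p ^ 3), ?_, ?_, ?_, ?_, ?_⟩
  · have : 2 * p * ((3 * b * p + n * a) / (4 * p ^ 3)) - -n * (a / (4 * p ^ 2)) =
        3 * (2 * b * p + n * a) / (4 * p ^ 2) := by
      field_simp
      ring
    rw [this]
    exact div_ne_zero (mul_ne_zero h3 hpsi) (mul_ne_zero h4 (pow_ne_zero 2 hp))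
  · field_simp
    ring
  · field_simp
    ring
  · field_simp
    linear_combination (-12 * p) * hc + 3 * a * hdisc
  · field_simp
    linear_combination (-4 * p ^ 2) * hd + (b * p - n * a) * hdisc + 4 * p * n * hc

end BinCubic

/-- a nonzero binary cubic has `μ(P)` nonzero nilpotent iff `P = φ²ξ` with
`φ, ξ` independent linear forms. -/
theorem stmt8 {k : Type*} [Field k] (h2 : (2 : k) ≠ 0) (h3 : (3 : k) ≠ 0)
    (P : BinCubic k) (hP : P ≠ (0 : BinCubic k)) :
    (mu P ≠ 0 ∧ mu P ^ 2 = 0) ↔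
      ∃ e f r s : k, e * s - f * r ≠ 0 ∧ toPoly P = lin e f ^ 2 * lin r s := by
  rw [mu_sq_eq_zero_iff]
  simp only [toPoly_eq_lin_sq_mul_lin_iff h2]
  constructor
  · rintro ⟨hmu, hdisc⟩
    by_cases hp : P.b ^ 2 - P.a * P.c = 0
    · have hq : P.c ^ 2 - P.d * P.b ≠ 0 := by
        intro hq
        have hq' : P.b * P.d - P.c ^ 2 = 0 := by linear_combination -hq
        have hn : P.a * P.d - P.b * P.c = 0 := by simpa [hp] using hdisc
        refine hmu ?_
        ext i j
        fin_cases i <;> fin_cases j <;> simp [mu, hp, hq', hn]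
      obtain ⟨e, f, r, s, h, ha, hb, hc, hd⟩ :=
        exists_double_root_of_disc_eq_zero h2 h3 (a := P.d) (b := P.c) (c := P.b) (d := P.a) hq
          (by linear_combination hdisc)
      refine ⟨f, e, s, r, fun h' => h (by linear_combination -h'), hd, ?_, ?_, ha⟩
      · linear_combination hc
      · linear_combination hb
    · exact exists_double_root_of_disc_eq_zero h2 h3 hp hdisc
  · rintro ⟨e, f, r, s, h, ha, hb, hc, hd⟩
    have h9 : (9 : k) ≠ 0 := by
      have : (9 : k) = 3 * 3 := by norm_num
      rw [this]; exact mul_ne_zero h3 h3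
    have hp : 9 * (P.b ^ 2 - P.a * P.c) = e ^ 2 * (e * s - f * r) ^ 2 := by
      calc _ = (3 * P.b) ^ 2 - 3 * P.a * (3 * P.c) := by ring
        _ = _ := by rw [ha, hb, hc]; ring
    have hq : 9 * (P.b * P.d - P.c ^ 2) = -(f ^ 2 * (e * s - f * r) ^ 2) := by
      calc _ = 3 * (3 * P.b) * P.d - (3 * P.c) ^ 2 := by ring
        _ = _ := by rw [hb, hc, hd]; ring
    have hn : 9 * (P.a * P.d - P.b * P.c) = -(2 * e * f * (e * s - f * r) ^ 2) := by
      calc _ = 9 * P.a * P.d - (3 * P.b) * (3 * P.c) := by ring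
        _ = _ := by rw [ha, hb, hc, hd]; ring
    constructor
    · intro hmu
      have hp0 : P.b ^ 2 - P.a * P.c = 0 := by
        simpa [mu, h2] using congrFun (congrFun hmu 1) 0
      have hq0 : P.b * P.d - P.c ^ 2 = 0 := by
        simpa [mu, h2] using congrFun (congrFun hmu 0) 1
      have he : e = 0 := by simpa [hp0, h] using hp.symm
      have hf : f = 0 := by simpa [hq0, h] using hq.symm
      exact h (by rw [he, hf]; ring)
    · refine mul_left_cancel₀ (mul_ne_zero h9 h9) ?_
      calc _ = (9 * (P.a * P.d - P.b * P.c)) ^ 2 +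
            4 * (9 * (P.b ^ 2 - P.a * P.c)) * (9 * (P.b * P.d - P.c ^ 2)) := by ring
        _ = _ := by rw [hp, hq, hn]; ring
end

section
/- (Sum of coprime cubes) Let P be a binary cubic over k and q ∈ k with q ≠ 0 and Q_n(P) = q². Set T₁ = (1/2)(P + (1/(3q))·Ψ(P)) and T₂ = (1/2)(P − (1/(3q))·Ψ(P)). Then T₁ and T₂ are coprime binary cubics with triple roots, P = T₁ + T₂, and Q_n(P) = ω(T₁,T₂)². -/
open MvPolynomial

open BinCubic
namespace BinCubic

variable {k : Type*} [Field k]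

theorem add_def (P Q : BinCubic k) :
    P + Q = ⟨P.a + Q.a, P.b + Q.b, P.c + Q.c, P.d + Q.d⟩ := rfl

theorem sub_def (P Q : BinCubic k) :
    P - Q = ⟨P.a - Q.a, P.b - Q.b, P.c - Q.c, P.d - Q.d⟩ := rfl

theorem smul_def (t : k) (P : BinCubic k) :
    t • P = ⟨t * P.a, t * P.b, t * P.c, t * P.d⟩ := rfl

theorem Psi_def (P : BinCubic k) :
    Psi P =
      ⟨-(3 * P.a * (P.a * P.d - P.b * P.c)) - 3 * P.b * (2 * (P.b ^ 2 - P.a * P.c)),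
       -(P.a * (2 * (P.b * P.d - P.c ^ 2))) - P.b * (P.a * P.d - P.b * P.c) -
         2 * P.c * (2 * (P.b ^ 2 - P.a * P.c)),
       -(2 * P.b * (2 * (P.b * P.d - P.c ^ 2))) + P.c * (P.a * P.d - P.b * P.c) -
         P.d * (2 * (P.b ^ 2 - P.a * P.c)),
       -(3 * P.c * (2 * (P.b * P.d - P.c ^ 2))) + 3 * P.d * (P.a * P.d - P.b * P.c)⟩ := rfl

/-- A binary cubic whose Hessian coefficients vanish is a multiple of the cube of a linear form. -/
theorem exists_eq_cubeForm (T : BinCubic k) (h₁ : T.a * T.c = T.b ^ 2)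
    (h₂ : T.b * T.d = T.c ^ 2) (h₃ : T.a * T.d = T.b * T.c) :
    ∃ lam e f : k, T = cubeForm lam e f := by
  obtain ⟨a, b, c, d⟩ := T
  dsimp only at h₁ h₂ h₃
  by_cases ha : a = 0
  · subst ha
    obtain rfl : b = 0 := by simpa using h₁.symm
    obtain rfl : c = 0 := by simpa using h₂.symm
    exact ⟨d, 0, 1, by simp [cubeForm]⟩
  · refine ⟨a, 1, b / a, ?_⟩
    simp only [cubeForm, mk.injEq]
    refine ⟨by ring, by field_simp, ?_, ?_⟩
    · field_simp
      linear_combination h₁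
    · field_simp
      linear_combination a * h₃ + b * h₁

/-- If `9u²·Q_n(P) = 1` then `h·(P + u·Ψ(P))` is a multiple of the cube of a linear form. -/
theorem exists_smul_add_smul_Psi_eq_cubeForm (P : BinCubic k) (h u : k)
    (hu : 9 * u ^ 2 * Qn P = 1) :
    ∃ lam e f : k, h • (P + u • Psi P) = cubeForm lam e f := by
  obtain ⟨a, b, c, d⟩ := P
  simp only [Qn] at hu
  apply exists_eq_cubeForm <;> simp only [add_def, smul_def, Psi_def]
  · linear_combination (-h ^ 2 * (a * c - b ^ 2)) * hu
  · linear_combination (-h ^ 2 * (b * d - c ^ 2)) * hu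
  · linear_combination (-h ^ 2 * (a * d - b * c)) * hu

/-- The symplectic form of two cubes of linear forms. -/
theorem omega_cubeForm (l e f m g h : k) :
    omega (cubeForm l e f) (cubeForm m g h) = l * m * (e * h - f * g) ^ 3 := by
  simp only [omega, cubeForm]
  ring

/-- Pairing `P + u·Ψ(P)` with `P - u·Ψ(P)`, both scaled by `h`. -/
theorem omega_smul_add_smul_sub (P : BinCubic k) (h u : k) :
    omega (h • (P + u • Psi P)) (h • (P - u • Psi P)) = -12 * h ^ 2 * u * Qn P := by
  simp only [omega, Qn, add_def, sub_def, smul_def, Psi_def]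
  ring

end BinCubic

/-- sum of coprime cubes.  If `Q_n(P) = q²` with `q ≠ 0` then
`T₁ = (1/2)(P + Ψ(P)/(3q))` and `T₂ = (1/2)(P − Ψ(P)/(3q))` are coprime cubics with
triple roots, `P = T₁ + T₂` and `Q_n(P) = ω(T₁,T₂)²`. -/
theorem stmt12 {k : Type*} [Field k] (h2 : (2 : k) ≠ 0) (h3 : (3 : k) ≠ 0)
    (P T1 T2 : BinCubic k) (q : k) (hq : q ≠ 0) (hQ : Qn P = q ^ 2)
    (hT1 : T1 = (1 / 2 : k) • (P + (1 / (3 * q)) • Psi P))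
    (hT2 : T2 = (1 / 2 : k) • (P - (1 / (3 * q)) • Psi P)) :
    (∃ lam1 e1 f1 lam2 e2 f2 : k, lam1 ≠ 0 ∧ lam2 ≠ 0 ∧
        T1 = cubeForm lam1 e1 f1 ∧ T2 = cubeForm lam2 e2 f2 ∧
        e1 * f2 - f1 * e2 ≠ 0) ∧
      P = T1 + T2 ∧ Qn P = omega T1 T2 ^ 2 := by
  have hu : 9 * (1 / (3 * q)) ^ 2 * Qn P = 1 := by
    rw [hQ]
    field_simp
    norm_num
  have hsub : P - (1 / (3 * q)) • Psi P = P + (-(1 / (3 * q))) • Psi P := by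
    simp only [add_def, sub_def, smul_def, mk.injEq]
    refine ⟨?_, ?_, ?_, ?_⟩ <;> ring
  have hsum : P = T1 + T2 := by
    obtain ⟨a, b, c, d⟩ := P
    simp only [hT1, hT2, add_def, sub_def, smul_def, mk.injEq]
    refine ⟨?_, ?_, ?_, ?_⟩ <;> field_simp <;> ring
  have homega : omega T1 T2 = -q := by
    rw [hT1, hT2, omega_smul_add_smul_sub, hQ]
    field_simp
    norm_num
  obtain ⟨l₁, e₁, f₁, h₁⟩ := exists_smul_add_smul_Psi_eq_cubeForm P (1 / 2) _ hu
  obtain ⟨l₂, e₂, f₂, h₂⟩ :=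
    exists_smul_add_smul_Psi_eq_cubeForm P (1 / 2) (-(1 / (3 * q))) (by rw [neg_sq, hu])
  rw [← hT1] at h₁
  rw [← hsub, ← hT2] at h₂
  have hne : l₁ * l₂ * (e₁ * f₂ - f₁ * e₂) ^ 3 ≠ 0 := by
    rw [← omega_cubeForm, ← h₁, ← h₂, homega]
    exact neg_ne_zero.mpr hq
  refine ⟨⟨l₁, e₁, f₁, l₂, e₂, f₂, ?_, ?_, h₁, h₂, ?_⟩, hsum, by rw [homega, hQ, neg_sq]⟩
  · rintro rfl
    simp at hne
  · rintro rfl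
    simp at hne
  · intro h
    simp [h] at hne
end

section
/- (Uniqueness of the coprime cube decomposition) Let P be a binary cubic over k and suppose P = T₁ + T₂ and P = T₁' + T₂', where T₁, T₂ are coprime binary cubics with triple roots and T₁', T₂' are coprime binary cubics with triple roots. Then either (T₁' = T₁ and T₂' = T₂) or (T₁' = T₂ and T₂' = T₁). -/
open MvPolynomial

open BinCubic

namespace BinCubic

theorem ext_coeff {k : Type*} {P Q : BinCubic k} (ha : P.a = Q.a) (hb : P.b = Q.b)
    (hc : P.c = Q.c) (hd : P.d = Q.d) : P = Q := by
  cases P; cases Q; simp_all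

variable {k : Type*} [Field k]

protected theorem add_comm (P Q : BinCubic k) : P + Q = Q + P :=
  ext_coeff (_root_.add_comm P.a Q.a) (_root_.add_comm P.b Q.b) (_root_.add_comm P.c Q.c)
    (_root_.add_comm P.d Q.d)

/-- A cube in a relation between two sums of two cubes is proportional to another of the cubes. -/
theorem det_mul_det_mul_det_eq_zero {l₁ e₁ f₁ l₂ e₂ f₂ l₃ e₃ f₃ l₄ e₄ f₄ : k} (hl : l₁ ≠ 0)
    (h : cubeForm l₁ e₁ f₁ + cubeForm l₂ e₂ f₂ = cubeForm l₃ e₃ f₃ + cubeForm l₄ e₄ f₄) :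
    (e₁ * f₂ - f₁ * e₂) * (e₁ * f₃ - f₁ * e₃) * (e₁ * f₄ - f₁ * e₄) = 0 := by
  have ha : l₁ * e₁ ^ 3 + l₂ * e₂ ^ 3 = l₃ * e₃ ^ 3 + l₄ * e₄ ^ 3 := congrArg BinCubic.a h
  have hb : l₁ * e₁ ^ 2 * f₁ + l₂ * e₂ ^ 2 * f₂ = l₃ * e₃ ^ 2 * f₃ + l₄ * e₄ ^ 2 * f₄ :=
    congrArg BinCubic.b h
  have hc : l₁ * e₁ * f₁ ^ 2 + l₂ * e₂ * f₂ ^ 2 = l₃ * e₃ * f₃ ^ 2 + l₄ * e₄ * f₄ ^ 2 :=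
    congrArg BinCubic.c h
  have hd : l₁ * f₁ ^ 3 + l₂ * f₂ ^ 3 = l₃ * f₃ ^ 3 + l₄ * f₄ ^ 3 := congrArg BinCubic.d h
  refine (mul_eq_zero.mp ?_).resolve_left hl
  linear_combination f₂ * f₃ * f₄ * ha - (e₂ * f₃ * f₄ + f₂ * e₃ * f₄ + f₂ * f₃ * e₄) * hb +
    (e₂ * e₃ * f₄ + e₂ * f₃ * e₄ + f₂ * e₃ * e₄) * hc - e₂ * e₃ * e₄ * hd

theorem exists_smul_of_det_eq_zero {e₁ f₁ e₂ f₂ e f : k} (h₁₂ : e₁ * f₂ - f₁ * e₂ ≠ 0)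
    (h : e₁ * f - f₁ * e = 0) : ∃ s, e = s * e₁ ∧ f = s * f₁ := by
  refine ⟨(e * f₂ - f * e₂) / (e₁ * f₂ - f₁ * e₂), ?_, ?_⟩
  · rw [div_mul_eq_mul_div, eq_div_iff h₁₂]
    linear_combination e₂ * h
  · rw [div_mul_eq_mul_div, eq_div_iff h₁₂]
    linear_combination f₂ * h

theorem cubeForm_smul (l s e f : k) : cubeForm l (s * e) (s * f) = cubeForm (l * s ^ 3) e f := by
  apply ext_coeff <;> simp only [cubeForm] <;> ring

/-- Two cubes of independent linear forms are linearly independent. -/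
theorem cubeForm_add_cubeForm_inj {l₁ l₂ l₃ l₄ e₁ f₁ e₂ f₂ : k}
    (h₁₂ : e₁ * f₂ - f₁ * e₂ ≠ 0)
    (h : cubeForm l₁ e₁ f₁ + cubeForm l₂ e₂ f₂ = cubeForm l₃ e₁ f₁ + cubeForm l₄ e₂ f₂) :
    l₃ = l₁ ∧ l₄ = l₂ := by
  have ha : l₁ * e₁ ^ 3 + l₂ * e₂ ^ 3 = l₃ * e₁ ^ 3 + l₄ * e₂ ^ 3 := congrArg BinCubic.a h
  have hb : l₁ * e₁ ^ 2 * f₁ + l₂ * e₂ ^ 2 * f₂ = l₃ * e₁ ^ 2 * f₁ + l₄ * e₂ ^ 2 * f₂ :=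
    congrArg BinCubic.b h
  have hc : l₁ * e₁ * f₁ ^ 2 + l₂ * e₂ * f₂ ^ 2 = l₃ * e₁ * f₁ ^ 2 + l₄ * e₂ * f₂ ^ 2 :=
    congrArg BinCubic.c h
  have hd : l₁ * f₁ ^ 3 + l₂ * f₂ ^ 3 = l₃ * f₁ ^ 3 + l₄ * f₂ ^ 3 := congrArg BinCubic.d h
  constructor
  · refine mul_right_cancel₀ (pow_ne_zero 3 h₁₂) ?_
    linear_combination -f₂ ^ 3 * ha + 3 * e₂ * f₂ ^ 2 * hb - 3 * e₂ ^ 2 * f₂ * hc + e₂ ^ 3 * hd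
  · refine mul_right_cancel₀ (pow_ne_zero 3 h₁₂) ?_
    linear_combination f₁ ^ 3 * ha - 3 * e₁ * f₁ ^ 2 * hb + 3 * e₁ ^ 2 * f₁ * hc - e₁ ^ 3 * hd

theorem cubeForm_eq_of_det_eq_zero {l₁ e₁ f₁ l₂ e₂ f₂ l₃ e₃ f₃ l₄ e₄ f₄ : k} (hl₂ : l₂ ≠ 0)
    (h₁₂ : e₁ * f₂ - f₁ * e₂ ≠ 0) (h₃₄ : e₃ * f₄ - f₃ * e₄ ≠ 0)
    (h : cubeForm l₁ e₁ f₁ + cubeForm l₂ e₂ f₂ = cubeForm l₃ e₃ f₃ + cubeForm l₄ e₄ f₄)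
    (h₁₃ : e₁ * f₃ - f₁ * e₃ = 0) :
    cubeForm l₃ e₃ f₃ = cubeForm l₁ e₁ f₁ ∧ cubeForm l₄ e₄ f₄ = cubeForm l₂ e₂ f₂ := by
  have h₂₁ : e₂ * f₁ - f₂ * e₁ ≠ 0 := fun h₀ => h₁₂ (by linear_combination -h₀)
  obtain ⟨s, rfl, rfl⟩ := exists_smul_of_det_eq_zero h₁₂ h₁₃
  have hs : s ≠ 0 := by
    rintro rfl
    simp at h₃₄
  have h₂₃ : e₂ * (s * f₁) - f₂ * (s * e₁) ≠ 0 := fun h₀ =>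
    mul_ne_zero hs h₂₁ (by linear_combination h₀)
  have h₂₄ : e₂ * f₄ - f₂ * e₄ = 0 :=
    (mul_eq_zero.mp (det_mul_det_mul_det_eq_zero hl₂
      ((BinCubic.add_comm _ _).trans h))).resolve_left (mul_ne_zero h₂₁ h₂₃)
  obtain ⟨t, rfl, rfl⟩ := exists_smul_of_det_eq_zero h₂₁ h₂₄
  rw [cubeForm_smul, cubeForm_smul] at h ⊢
  obtain ⟨h₁, h₂⟩ := cubeForm_add_cubeForm_inj h₁₂ h
  rw [h₁, h₂]
  exact ⟨rfl, rfl⟩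

end BinCubic

/-- uniqueness (up to order) of the decomposition of a binary cubic as a
sum of two coprime cubics with triple roots. -/
theorem stmt13 {k : Type*} [Field k] (h2 : (2 : k) ≠ 0) (h3 : (3 : k) ≠ 0)
    (P T1 T2 T1' T2' : BinCubic k)
    (hT : ∃ lam1 e1 f1 lam2 e2 f2 : k, lam1 ≠ 0 ∧ lam2 ≠ 0 ∧
        T1 = cubeForm lam1 e1 f1 ∧ T2 = cubeForm lam2 e2 f2 ∧
        e1 * f2 - f1 * e2 ≠ 0)
    (hT' : ∃ lam1 e1 f1 lam2 e2 f2 : k, lam1 ≠ 0 ∧ lam2 ≠ 0 ∧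
        T1' = cubeForm lam1 e1 f1 ∧ T2' = cubeForm lam2 e2 f2 ∧
        e1 * f2 - f1 * e2 ≠ 0)
    (hP : P = T1 + T2) (hP' : P = T1' + T2') :
    (T1' = T1 ∧ T2' = T2) ∨ (T1' = T2 ∧ T2' = T1) := by
  obtain ⟨l₁, e₁, f₁, l₂, e₂, f₂, hl₁, hl₂, rfl, rfl, h₁₂⟩ := hT
  obtain ⟨l₃, e₃, f₃, l₄, e₄, f₄, -, -, rfl, rfl, h₃₄⟩ := hT'
  have h := hP.symm.trans hP'
  rcases mul_eq_zero.mp (det_mul_det_mul_det_eq_zero hl₁ h) with h₀ | h₁₄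
  · exact Or.inl (cubeForm_eq_of_det_eq_zero hl₂ h₁₂ h₃₄ h
      ((mul_eq_zero.mp h₀).resolve_left h₁₂))
  · have h₄₃ : e₄ * f₃ - f₄ * e₃ ≠ 0 := fun h₀ => h₃₄ (by linear_combination -h₀)
    exact Or.inr (cubeForm_eq_of_det_eq_zero hl₂ h₁₂ h₄₃ (h.trans (BinCubic.add_comm _ _))
      h₁₄).symm
end

section
/- Let P be a binary cubic over k with Q_n(P) a nonzero square in k, and let φ₁, φ₂ be linear forms in k[x,y] with Ω(φ₁,φ₂) ≠ 0. Then there exist λ₁, λ₂ ∈ k* with P = λ₁φ₁³ + λ₂φ₂³ if and only if φ₁ and φ₂ are both eigenvectors of the action of μ(P) on linear forms. Moreover, if P = λ₁φ₁³ + λ₂φ₂³ with λ₁, λ₂ ∈ k*, then setting q = λ₁λ₂·Ω(φ₁,φ₂)³ one has μ(P)·φ₁ = −q·φ₁ and μ(P)·φ₂ = q·φ₂ (so q is a square root of Q_n(P)). -/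
open MvPolynomial

open BinCubic
namespace BinCubic

variable {k : Type*} [Field k]

/-- The Hessian of `P` vanishes at the zero of any eigenvector of `μ(P)`. -/
theorem hessian_eq_zero_of_linAct (h2 : (2 : k) ≠ 0) {P : BinCubic k} {e f t : k}
    (h : linAct (mu P) e f = (t * e, t * f)) :
    (P.a * P.c - P.b ^ 2) * f ^ 2 - (P.a * P.d - P.b * P.c) * e * f +
      (P.b * P.d - P.c ^ 2) * e ^ 2 = 0 := by
  simp only [linAct, mu, Prod.mk.injEq, Matrix.of_apply, Matrix.cons_val', Matrix.cons_val_zero,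
    Matrix.cons_val_one, Matrix.cons_val_fin_one] at h
  obtain ⟨hx, hy⟩ := h
  apply (mul_eq_zero.mp _).resolve_left h2
  linear_combination f * hx - e * hy

/-- If `Q_n(P) ≠ 0` and the Hessian of `P` vanishes at the zeros of two independent linear forms,
then `P` is a sum of nonzero multiples of the cubes of these forms. -/
theorem exists_eq_cubeForm_add_cubeForm {P : BinCubic k} {e1 f1 e2 f2 : k}
    (hQ : Qn P ≠ 0) (hbasis : e1 * f2 - f1 * e2 ≠ 0)
    (h1 : (P.a * P.c - P.b ^ 2) * f1 ^ 2 - (P.a * P.d - P.b * P.c) * e1 * f1 +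
      (P.b * P.d - P.c ^ 2) * e1 ^ 2 = 0)
    (h2 : (P.a * P.c - P.b ^ 2) * f2 ^ 2 - (P.a * P.d - P.b * P.c) * e2 * f2 +
      (P.b * P.d - P.c ^ 2) * e2 ^ 2 = 0) :
    ∃ lam1 lam2 : k, lam1 ≠ 0 ∧ lam2 ≠ 0 ∧ P = cubeForm lam1 e1 f1 + cubeForm lam2 e2 f2 := by
  obtain ⟨a, b, c, d⟩ := P
  simp only [Qn] at hQ h1 h2
  obtain ⟨w, hw⟩ : ∃ w, w = e1 * f2 - f1 * e2 := ⟨_, rfl⟩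
  rw [← hw] at hbasis
  obtain ⟨A, hA⟩ : ∃ A, A = a * f2 ^ 3 - 3 * b * f2 ^ 2 * e2 + 3 * c * f2 * e2 ^ 2 - d * e2 ^ 3 :=
    ⟨_, rfl⟩
  obtain ⟨B, hB⟩ : ∃ B, B = -(a * f2 ^ 2 * f1) + b * (f2 ^ 2 * e1 + 2 * f1 * f2 * e2)
      - c * (e2 ^ 2 * f1 + 2 * e1 * e2 * f2) + d * e2 ^ 2 * e1 := ⟨_, rfl⟩
  obtain ⟨C, hC⟩ : ∃ C, C = a * f1 ^ 2 * f2 - b * (f1 ^ 2 * e2 + 2 * f1 * f2 * e1)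
      + c * (e1 ^ 2 * f2 + 2 * e1 * e2 * f1) - d * e1 ^ 2 * e2 := ⟨_, rfl⟩
  obtain ⟨D, hD⟩ : ∃ D, D = -(a * f1 ^ 3) + 3 * b * f1 ^ 2 * e1 - 3 * c * f1 * e1 ^ 2 + d * e1 ^ 3 :=
    ⟨_, rfl⟩
  have hBD : B * D - C ^ 2 = 0 := by
    subst hB hC hD
    linear_combination (e1 * f2 - f1 * e2) ^ 2 * h1
  have hAC : A * C - B ^ 2 = 0 := by
    subst hA hB hC
    linear_combination (e1 * f2 - f1 * e2) ^ 2 * h2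
  have hdisc : (A * D - B * C) ^ 2 ≠ 0 := by
    have key : (A * D - B * C) ^ 2 = w ^ 6 * (a ^ 2 * d ^ 2 - 3 * b ^ 2 * c ^ 2
        - 6 * a * b * c * d + 4 * b ^ 3 * d + 4 * a * c ^ 3) := by
      have : (A * D - B * C) ^ 2 - 4 * (B * D - C ^ 2) * (A * C - B ^ 2)
          = w ^ 6 * (a ^ 2 * d ^ 2 - 3 * b ^ 2 * c ^ 2
            - 6 * a * b * c * d + 4 * b ^ 3 * d + 4 * a * c ^ 3) := by
        subst hA hB hC hD hw
        ring
      linear_combination this + 4 * (A * C - B ^ 2) * hBD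
    rw [key]
    exact mul_ne_zero (pow_ne_zero _ hbasis) hQ
  have hne : A * D - B * C ≠ 0 := fun h => hdisc (by rw [h]; ring)
  have hB0 : B = 0 := ((mul_eq_zero (a := B) (b := A * D - B * C)).mp
    (by linear_combination A * hBD + C * hAC)).resolve_right hne
  have hC0 : C = 0 := ((mul_eq_zero (a := C) (b := A * D - B * C)).mp
    (by linear_combination D * hAC + B * hBD)).resolve_right hne
  have hAD : A * D ≠ 0 := by simpa [hB0] using hne
  refine ⟨A / w ^ 3, D / w ^ 3, div_ne_zero (left_ne_zero_of_mul hAD) (pow_ne_zero _ hbasis),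
    div_ne_zero (right_ne_zero_of_mul hAD) (pow_ne_zero _ hbasis), ?_⟩
  have hw3 : w ^ 3 ≠ 0 := pow_ne_zero _ hbasis
  apply ext_coeff
  · change a = A / w ^ 3 * e1 ^ 3 + D / w ^ 3 * e2 ^ 3
    have : w ^ 3 * a = A * e1 ^ 3 + 3 * B * e1 ^ 2 * e2 + 3 * C * e1 * e2 ^ 2 + D * e2 ^ 3 := by
      subst hA hB hC hD hw
      ring
    rw [hB0, hC0] at this
    field_simp
    linear_combination this
  · change b = A / w ^ 3 * e1 ^ 2 * f1 + D / w ^ 3 * e2 ^ 2 * f2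
    have : w ^ 3 * b = A * e1 ^ 2 * f1 + B * (e1 ^ 2 * f2 + 2 * e1 * e2 * f1)
        + C * (e2 ^ 2 * f1 + 2 * e1 * e2 * f2) + D * e2 ^ 2 * f2 := by
      subst hA hB hC hD hw
      ring
    rw [hB0, hC0] at this
    field_simp
    linear_combination this
  · change c = A / w ^ 3 * e1 * f1 ^ 2 + D / w ^ 3 * e2 * f2 ^ 2
    have : w ^ 3 * c = A * e1 * f1 ^ 2 + B * (f1 ^ 2 * e2 + 2 * e1 * f1 * f2)
        + C * (f2 ^ 2 * e1 + 2 * e2 * f1 * f2) + D * e2 * f2 ^ 2 := by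
      subst hA hB hC hD hw
      ring
    rw [hB0, hC0] at this
    field_simp
    linear_combination this
  · change d = A / w ^ 3 * f1 ^ 3 + D / w ^ 3 * f2 ^ 3
    have : w ^ 3 * d = A * f1 ^ 3 + 3 * B * f1 ^ 2 * f2 + 3 * C * f1 * f2 ^ 2 + D * f2 ^ 3 := by
      subst hA hB hC hD hw
      ring
    rw [hB0, hC0] at this
    field_simp
    linear_combination this

theorem cubeForm_add_cubeForm (lam1 lam2 e1 f1 e2 f2 : k) :
    cubeForm lam1 e1 f1 + cubeForm lam2 e2 f2 =
      ⟨lam1 * e1 ^ 3 + lam2 * e2 ^ 3, lam1 * e1 ^ 2 * f1 + lam2 * e2 ^ 2 * f2,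
        lam1 * e1 * f1 ^ 2 + lam2 * e2 * f2 ^ 2, lam1 * f1 ^ 3 + lam2 * f2 ^ 3⟩ :=
  rfl

theorem linAct_mu_cubeForm_add_left (lam1 lam2 e1 f1 e2 f2 : k) :
    linAct (mu (cubeForm lam1 e1 f1 + cubeForm lam2 e2 f2)) e1 f1 =
      (-(lam1 * lam2 * (e1 * f2 - f1 * e2) ^ 3) * e1,
        -(lam1 * lam2 * (e1 * f2 - f1 * e2) ^ 3) * f1) := by
  simp only [cubeForm_add_cubeForm, linAct, mu, Prod.mk.injEq, Matrix.of_apply, Matrix.cons_val',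
    Matrix.cons_val_zero, Matrix.cons_val_one, Matrix.cons_val_fin_one]
  constructor <;> ring

theorem linAct_mu_cubeForm_add_right (lam1 lam2 e1 f1 e2 f2 : k) :
    linAct (mu (cubeForm lam1 e1 f1 + cubeForm lam2 e2 f2)) e2 f2 =
      (lam1 * lam2 * (e1 * f2 - f1 * e2) ^ 3 * e2,
        lam1 * lam2 * (e1 * f2 - f1 * e2) ^ 3 * f2) := by
  simp only [cubeForm_add_cubeForm, linAct, mu, Prod.mk.injEq, Matrix.of_apply, Matrix.cons_val',
    Matrix.cons_val_zero, Matrix.cons_val_one, Matrix.cons_val_fin_one]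
  constructor <;> ring

theorem Qn_cubeForm_add (lam1 lam2 e1 f1 e2 f2 : k) :
    Qn (cubeForm lam1 e1 f1 + cubeForm lam2 e2 f2) =
      (lam1 * lam2 * (e1 * f2 - f1 * e2) ^ 3) ^ 2 := by
  simp only [cubeForm_add_cubeForm, Qn]
  ring

end BinCubic

/-- for `Q_n(P)` a nonzero square and a basis `φ₁, φ₂` of linear forms,
`P = λ₁φ₁³ + λ₂φ₂³` (with `λᵢ ∈ k*`) iff `φ₁, φ₂` are eigenvectors of `μ(P)`; and then
with `q = λ₁λ₂Ω(φ₁,φ₂)³` one has `μ(P)·φ₁ = −qφ₁`, `μ(P)·φ₂ = qφ₂` and `Q_n(P) = q²`. -/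
theorem stmt15 {k : Type*} [Field k] (h2 : (2 : k) ≠ 0) (h3 : (3 : k) ≠ 0)
    (P : BinCubic k) (hQ : ∃ q0 : k, q0 ≠ 0 ∧ Qn P = q0 ^ 2)
    (e1 f1 e2 f2 : k) (hbasis : e1 * f2 - f1 * e2 ≠ 0) :
    ((∃ lam1 lam2 : k, lam1 ≠ 0 ∧ lam2 ≠ 0 ∧
        P = cubeForm lam1 e1 f1 + cubeForm lam2 e2 f2) ↔
      ((∃ t : k, linAct (mu P) e1 f1 = (t * e1, t * f1)) ∧
        ∃ t : k, linAct (mu P) e2 f2 = (t * e2, t * f2))) ∧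
    (∀ lam1 lam2 : k, lam1 ≠ 0 → lam2 ≠ 0 →
      P = cubeForm lam1 e1 f1 + cubeForm lam2 e2 f2 →
      linAct (mu P) e1 f1 =
          (-(lam1 * lam2 * (e1 * f2 - f1 * e2) ^ 3) * e1,
            -(lam1 * lam2 * (e1 * f2 - f1 * e2) ^ 3) * f1) ∧
        linAct (mu P) e2 f2 =
          (lam1 * lam2 * (e1 * f2 - f1 * e2) ^ 3 * e2,
            lam1 * lam2 * (e1 * f2 - f1 * e2) ^ 3 * f2) ∧
        Qn P = (lam1 * lam2 * (e1 * f2 - f1 * e2) ^ 3) ^ 2) := by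
  refine ⟨⟨?_, ?_⟩, ?_⟩
  · rintro ⟨lam1, lam2, -, -, rfl⟩
    exact ⟨⟨_, linAct_mu_cubeForm_add_left ..⟩, ⟨_, linAct_mu_cubeForm_add_right ..⟩⟩
  · rintro ⟨⟨t1, ht1⟩, ⟨t2, ht2⟩⟩
    obtain ⟨q0, hq0, hq⟩ := hQ
    exact exists_eq_cubeForm_add_cubeForm (hq ▸ pow_ne_zero 2 hq0) hbasis
      (hessian_eq_zero_of_linAct h2 ht1) (hessian_eq_zero_of_linAct h2 ht2)
  · rintro lam1 lam2 - - rfl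
    exact ⟨linAct_mu_cubeForm_add_left .., linAct_mu_cubeForm_add_right .., Qn_cubeForm_add ..⟩
end
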